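/- arXiv:2604.04006 — 2 statements merged into one kernel-verified Lean document; each statement's English description precedes it below -/
import Mathlib

section
/- Let p be an odd prime. Then the product of binomial coefficients C(3p, p) · C(2p, p) is congruent to 6 modulo p^3. -/
open Polynomial in
theorem aux_coeff_two (p : ℕ) (hp : p.Prime) (h3 : 3 < p) :
    (p : ℤ) ∣ (∏ i ∈ Finset.range (p - 1), (X - C ((i : ℤ) + 1))).coeff 2 := by
  have : Fact p.Prime := ⟨hp⟩
  rw [← ZMod.intCast_zmod_eq_zero_iff_dvd]
  have key : (∏ i ∈ Finset.range (p - 1), (X - C ((i : ZMod p) + 1))) = X ^ (p - 1) - C 1 := by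
    have hm : (∏ i ∈ Finset.range (p - 1), (X - C ((i : ZMod p) + 1))).Monic :=
      monic_prod_of_monic _ _ fun i _ => monic_X_sub_C _
    have hd : (∏ i ∈ Finset.range (p - 1), (X - C ((i : ZMod p) + 1))).degree
        = ((p - 1 : ℕ) : WithBot ℕ) := by
      rw [degree_prod]
      simp only [degree_X_sub_C]
      simp
    have hm2 : (X ^ (p - 1) - C 1 : (ZMod p)[X]).Monic := monic_X_pow_sub_C 1 (by omega)
    have hd2 : (X ^ (p - 1) - C 1 : (ZMod p)[X]).degree = ((p - 1 : ℕ) : WithBot ℕ) :=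
      degree_X_pow_sub_C (by omega) 1
    have hne : ∀ i ∈ Finset.range (p - 1), ((i : ZMod p) + 1) ≠ 0 := by
      intro i hi h
      have hi := Finset.mem_range.1 hi
      have h' : ((i + 1 : ℕ) : ZMod p) = 0 := by exact_mod_cast h
      rw [ZMod.natCast_eq_zero_iff] at h'
      have := Nat.le_of_dvd (by omega) h'
      omega
    refine eq_of_degree_sub_lt_of_eval_index_eq (s := Finset.range (p - 1))
      (v := fun i : ℕ => (i : ZMod p) + 1) ?_ ?_ ?_
    · intro i hi j hj h
      have hi := Finset.mem_range.1 (Finset.mem_coe.1 hi)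
      have hj := Finset.mem_range.1 (Finset.mem_coe.1 hj)
      have h' : (i : ZMod p) = (j : ZMod p) := add_right_cancel h
      rw [ZMod.natCast_eq_natCast_iff'] at h'
      rwa [Nat.mod_eq_of_lt (by omega), Nat.mod_eq_of_lt (by omega)] at h'
    · rw [Finset.card_range, ← hd]
      refine degree_sub_lt_left (hd.trans hd2.symm) hm.ne_zero ?_
      rw [hm.leadingCoeff, hm2.leadingCoeff]
    · intro i hi
      rw [eval_prod, Finset.prod_eq_zero hi (by simp)]
      simp [ZMod.pow_card_sub_one_eq_one (hne i hi)]
  have h2 := congrArg (fun f : (ZMod p)[X] => f.coeff 2) key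
  simp only [coeff_sub, coeff_X_pow, coeff_C] at h2
  rw [if_neg (by omega), if_neg (by norm_num), sub_zero] at h2
  rw [← h2, ← eq_intCast (Int.castRingHom (ZMod p)), ← coeff_map, Polynomial.map_prod]
  simp

open Polynomial in
theorem aux_eval (q m : ℕ) (hm : 0 < m) :
    (Nat.choose (m * (q + 1)) (q + 1) : ℤ) * (q.factorial : ℤ)
      = m * (∏ i ∈ Finset.range q, (X - C ((i : ℤ) + 1))).eval ((m : ℤ) * (q + 1)) := by
  obtain ⟨n, hn⟩ : ∃ n, m * (q + 1) = n + 1 := ⟨m * (q + 1) - 1, by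
    have : 0 < m * (q + 1) := by positivity
    omega⟩
  have hqn : q ≤ n := by nlinarith
  have h1 := Nat.add_one_mul_choose_eq n q
  have h2 := Nat.descFactorial_eq_factorial_mul_choose n q
  rw [Nat.descFactorial_eq_prod_range] at h2
  have h3 : (∏ i ∈ Finset.range q, (X - C ((i : ℤ) + 1))).eval ((m : ℤ) * (q + 1))
      = ((q.factorial * n.choose q : ℕ) : ℤ) := by
    rw [← h2, eval_prod]
    push_cast
    refine Finset.prod_congr rfl fun i hi => ?_
    have : i < q := Finset.mem_range.1 hi
    have h4 : ((m : ℤ) * (q + 1)) = n + 1 := by exact_mod_cast hn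
    rw [h4, Nat.cast_sub (by omega)]
    simp
  rw [h3, hn]
  rw [← hn] at h1
  have h5 : m * n.choose q = (m * (q+1)).choose (q + 1) := by
    apply Nat.eq_of_mul_eq_mul_right (Nat.succ_pos q)
    rw [Nat.succ_eq_add_one]
    linarith
  rw [← hn, ← h5]
  push_cast
  ring

open Polynomial in
theorem choose_three_p_mul_choose_two_p (p : ℕ) (hp : p.Prime) (hodd : Odd p) :
    Nat.choose (3 * p) p * Nat.choose (2 * p) p ≡ 6 [MOD p ^ 3] := by
  have hp2 := hp.two_le
  rcases Nat.lt_or_ge 3 p with h3 | h3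
  swap
  · have : p = 3 := by
      obtain ⟨k, hk⟩ := hodd
      omega
    subst this
    decide
  have ha := aux_coeff_two p hp h3
  obtain ⟨q, rfl⟩ : ∃ q, p = q + 1 := ⟨p - 1, by omega⟩
  have hq : Even q := by
    rcases Nat.even_or_odd q with h | h
    · exact h
    · exact absurd hodd (by simpa using h.add_one)
  have e1 := aux_eval q 1 (by norm_num)
  have e2 := aux_eval q 2 (by norm_num)
  have e3 := aux_eval q 3 (by norm_num)
  rw [Nat.add_sub_cancel] at ha
  have e0 : (∏ i ∈ Finset.range q, (X - C ((i : ℤ) + 1))).coeff 0 = (q.factorial : ℤ) := by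
    rw [coeff_zero_eq_eval_zero, eval_prod, ← Finset.prod_range_add_one_eq_factorial]
    push_cast
    simp only [eval_sub, eval_X, eval_C, zero_sub]
    rw [Finset.prod_neg]
    simp [hq.neg_one_pow]
  generalize (∏ i ∈ Finset.range q, (X - C ((i : ℤ) + 1))) = f at *
  have hf : ∃ g : ℤ[X], f = C (f.coeff 0) + C (f.coeff 1) * X + C (f.coeff 2) * X ^ 2 + X ^ 3 * g := by
    refine ⟨f.divX.divX.divX, ?_⟩
    have h1 := divX_mul_X_add f
    have h2 := divX_mul_X_add f.divX
    have h3 := divX_mul_X_add f.divX.divX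
    simp only [coeff_divX] at h2 h3
    rw [zero_add] at h2 h3
    linear_combination -h1 - X * h2 - X ^ 2 * h3
  obtain ⟨g, hg⟩ := hf
  have hev : ∀ x : ℤ, f.eval x = f.coeff 0 + f.coeff 1 * x + f.coeff 2 * x ^ 2 + x ^ 3 * g.eval x := by
    intro x
    conv_lhs => rw [hg]
    simp
  rw [hev, e0] at e1 e2 e3
  obtain ⟨b, hb⟩ := ha
  rw [hb] at e1 e2 e3
  simp only [one_mul, Nat.choose_self] at e1
  push_cast at e1 e2 e3
  simp only [one_mul] at e1
  have hcop : IsCoprime (((q : ℤ) + 1) ^ 3) ((q.factorial : ℤ)) := by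
    apply IsCoprime.pow_left
    have : Nat.Coprime (q + 1) q.factorial :=
      (Nat.coprime_factorial_iff (by omega)).2 (by rw [hp.minFac_eq]; omega)
    exact_mod_cast Nat.isCoprime_iff_coprime.2 this
  have k2 : ((q : ℤ) + 1) ^ 3 ∣ ((2 * (q + 1)).choose (q + 1) : ℤ) - 2 := by
    apply hcop.dvd_of_dvd_mul_right
    refine ⟨2 * (2 * b + 8 * g.eval (2 * ((q : ℤ) + 1)) - 2 * g.eval ((q : ℤ) + 1)), ?_⟩
    linear_combination e2 - 4 * e1
  have k3 : ((q : ℤ) + 1) ^ 3 ∣ ((3 * (q + 1)).choose (q + 1) : ℤ) - 3 := by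
    apply hcop.dvd_of_dvd_mul_right
    refine ⟨3 * (6 * b + 27 * g.eval (3 * ((q : ℤ) + 1)) - 3 * g.eval ((q : ℤ) + 1)), ?_⟩
    linear_combination e3 - 9 * e1
  apply Nat.ModEq.symm
  rw [Nat.modEq_iff_dvd]
  push_cast
  obtain ⟨c, hc⟩ := k2
  obtain ⟨d, hd⟩ := k3
  refine ⟨d * ((2 * (q + 1)).choose (q + 1) : ℤ) + 3 * c, ?_⟩
  linear_combination ((2 * (q + 1)).choose (q + 1) : ℤ) * hd + 3 * hc
end

section
/- Let p be an odd prime. Then the binomial coefficient C((7p−1)/2, p) satisfies C((7p−1)/2, p) ≡ 3 − 6p·q_p(2) (mod p^2). -/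
/-- The Fermat quotient `q_p(2) = (2^(p-1) - 1)/p`, an integer for odd prime `p`. -/
def fermatQuotient2 (p : ℕ) : ℤ := ((2 : ℤ) ^ (p - 1) - 1) / p

theorem aux_inv (p : ℕ) (hp : p.Prime) (k : ℕ) (h0 : 0 < k) (hk : k < p) :
    (k : ZMod (p ^ 2)) * (k : ZMod (p ^ 2))⁻¹ = 1 := by
  apply ZMod.coe_mul_inv_eq_one
  exact Nat.Coprime.pow_right 2 ((Nat.Prime.coprime_iff_not_dvd hp).mpr (Nat.not_dvd_of_pos_of_lt h0 hk)).symm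

theorem aux_sq (p : ℕ) : (p : ZMod (p ^ 2)) * p = 0 := by
  have := ZMod.natCast_self (p ^ 2)
  push_cast at this
  rw [← this]; ring

def auxH (p j : ℕ) : ZMod (p ^ 2) :=
  ∑ i ∈ Finset.range j, ((i + 1 : ℕ) : ZMod (p ^ 2))⁻¹

theorem auxH_succ (p j : ℕ) : auxH p (j + 1) = auxH p j + ((j + 1 : ℕ) : ZMod (p ^ 2))⁻¹ := by
  simp [auxH, Finset.sum_range_succ]

/-- `C(2p+j, j) = 1 + 2 p H_j`. -/
theorem aux_choose2 (p : ℕ) (hp : p.Prime) (j : ℕ) (hj : j < p) :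
    (Nat.choose (2 * p + j) j : ZMod (p ^ 2)) = 1 + 2 * p * auxH p j := by
  induction j with
  | zero => simp [auxH]
  | succ j ih =>
    have ih := ih (by omega)
    have hi := aux_inv p hp (j + 1) (by omega) hj
    have hs := aux_sq p
    have h := congrArg (Nat.cast : ℕ → ZMod (p ^ 2)) (Nat.add_one_mul_choose_eq (2 * p + j) j)
    rw [auxH_succ]
    rw [show 2 * p + (j + 1) = 2 * p + j + 1 by ring]
    push_cast at *
    rw [ih] at h
    generalize (Nat.choose (2 * p + j + 1) (j + 1) : ZMod (p ^ 2)) = c at *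
    generalize ((j : ZMod (p ^ 2)) + 1)⁻¹ = v at *
    generalize (p : ZMod (p ^ 2)) = P at *
    linear_combination (-v) * h - (c - 1 - 2 * P * auxH p j) * hi + 4 * auxH p j * v * hs

theorem aux_choose3 (p : ℕ) (hp : p.Prime) (h3 : (Nat.choose (3 * p) p : ZMod (p ^ 2)) = 3)
    (j : ℕ) (hj : j < p) :
    (Nat.choose (3 * p + j) p : ZMod (p ^ 2)) = 3 * (1 + p * auxH p j) := by
  induction j with
  | zero => simp [auxH, h3]
  | succ j ih =>
    have ih := ih (by omega)
    have hi := aux_inv p hp (j + 1) (by omega) hj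
    have hs := aux_sq p
    have h := Nat.choose_mul_succ_eq (3 * p + j) p
    rw [show 3 * p + j + 1 - p = 2 * p + j + 1 by omega] at h
    have h := congrArg (Nat.cast : ℕ → ZMod (p ^ 2)) h
    rw [auxH_succ]
    rw [show 3 * p + (j + 1) = 3 * p + j + 1 by ring]
    push_cast at *
    rw [ih] at h
    generalize (Nat.choose (3 * p + j + 1) p : ZMod (p ^ 2)) = c at *
    generalize ((j : ZMod (p ^ 2)) + 1)⁻¹ = v at *
    generalize (p : ZMod (p ^ 2)) = P at *
    generalize auxH p j = H at *
    generalize (j : ZMod (p ^ 2)) = J at *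
    -- the unit 2P+J+1 has inverse v - 2 P v^2
    have hu : (2 * P + J + 1) * (v - 2 * P * v ^ 2) = 1 := by
      linear_combination (1 - 2 * P * v) * hi - 4 * v ^ 2 * hs
    have key : (2 * P + J + 1) * (c - 3 * (1 + P * (H + v))) = 0 := by
      linear_combination (-1) * h - 3 * P * hi + (3 * H - 6 * v) * hs
    have : c - 3 * (1 + P * (H + v)) = 0 := by
      linear_combination (v - 2 * P * v ^ 2) * key - (c - 3 * (1 + P * (H + v))) * hu
    linear_combination this

theorem aux_unit2 (p : ℕ) (hodd : Odd p) (x : ZMod (p ^ 2)) (h : 2 * x = 0) : x = 0 := by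
  have h2 : ((2 : ℕ) : ZMod (p ^ 2)) * ((2 : ℕ) : ZMod (p ^ 2))⁻¹ = 1 := by
    apply ZMod.coe_mul_inv_eq_one
    exact Nat.Coprime.pow_right 2 (Nat.coprime_two_left.mpr hodd)
  push_cast at h2
  linear_combination (2 : ZMod (p ^ 2))⁻¹ * h - x * h2

theorem aux_wol (p : ℕ) (hp : p.Prime) (hodd : Odd p) :
    (p : ZMod (p ^ 2)) * auxH p (p - 1) = 0 := by
  apply aux_unit2 p hodd
  have h1 : auxH p (p - 1) = ∑ i ∈ Finset.range (p - 1), ((p - 1 - i : ℕ) : ZMod (p ^ 2))⁻¹ := by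
    rw [auxH, ← Finset.sum_range_reflect]
    apply Finset.sum_congr rfl
    intro i hi
    rw [Finset.mem_range] at hi
    congr 2
    omega
  have : 2 * ((p : ZMod (p ^ 2)) * auxH p (p - 1)) = p * (auxH p (p - 1) + auxH p (p - 1)) := by ring
  rw [this]
  nth_rewrite 2 [h1]
  rw [auxH, ← Finset.sum_add_distrib, Finset.mul_sum]
  apply Finset.sum_eq_zero
  intro i hi
  rw [Finset.mem_range] at hi
  have a := aux_inv p hp (i + 1) (by omega) (by omega)
  have b := aux_inv p hp (p - 1 - i) (by omega) (by omega)
  have hs := aux_sq p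
  have e : ((p - 1 - i : ℕ) : ZMod (p ^ 2)) + ((i + 1 : ℕ) : ZMod (p ^ 2)) = p := by
    rw [← Nat.cast_add]; congr 1; omega
  generalize ((p - 1 - i : ℕ) : ZMod (p ^ 2)) = x at *
  generalize ((i + 1 : ℕ) : ZMod (p ^ 2)) = y at *
  generalize (p : ZMod (p ^ 2)) = P at *
  linear_combination (-P * y⁻¹) * b - P * x⁻¹ * a + P * x⁻¹ * y⁻¹ * e + x⁻¹ * y⁻¹ * hs

theorem aux_three (p : ℕ) (hp : p.Prime) (hodd : Odd p) :
    (Nat.choose (3 * p) p : ZMod (p ^ 2)) = 3 := by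
  have hpos := hp.pos
  have h := Nat.add_one_mul_choose_eq (2 * p + (p - 1)) (p - 1)
  rw [show 2 * p + (p - 1) + 1 = 3 * p by omega, show p - 1 + 1 = p by omega] at h
  have h' : Nat.choose (3 * p) p = 3 * Nat.choose (2 * p + (p - 1)) (p - 1) := by
    apply Nat.eq_of_mul_eq_mul_right hpos
    rw [← h]; ring
  rw [h']
  push_cast
  rw [aux_choose2 p hp (p - 1) (by omega)]
  linear_combination 6 * aux_wol p hp hodd

/-- `p C(p-1,k) = p (-1)^k`. -/
theorem aux_pm (p : ℕ) (hp : p.Prime) (k : ℕ) (hk : k < p) :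
    (p : ZMod (p ^ 2)) * (Nat.choose (p - 1) k : ZMod (p ^ 2)) = p * (-1) ^ k := by
  induction k with
  | zero => simp
  | succ k ih =>
    have ih := ih (by omega)
    have h := Nat.choose_succ_succ (p - 1) k
    rw [Nat.succ_eq_add_one, Nat.succ_eq_add_one, show p - 1 + 1 = p by omega] at h
    obtain ⟨c, hc⟩ := hp.dvd_choose_self (k := k + 1) (by omega) hk
    rw [hc] at h
    have h := congrArg (Nat.cast : ℕ → ZMod (p ^ 2)) h
    push_cast at h
    rw [pow_succ (-1 : ZMod (p ^ 2))]
    have hs := aux_sq p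
    generalize (Nat.choose (p - 1) (k + 1) : ZMod (p ^ 2)) = x at *
    generalize (Nat.choose (p - 1) k : ZMod (p ^ 2)) = y at *
    generalize (p : ZMod (p ^ 2)) = P at *
    generalize (c : ZMod (p ^ 2)) = d at *
    generalize (-1 : ZMod (p ^ 2)) ^ k = z at *
    linear_combination (-P) * h - ih + d * hs

theorem aux_choose1 (p : ℕ) (hp : p.Prime) (k : ℕ) (hk : k + 1 < p) :
    (Nat.choose p (k + 1) : ZMod (p ^ 2)) = p * ((-1) ^ k * ((k + 1 : ℕ) : ZMod (p ^ 2))⁻¹) := by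
  have h := Nat.add_one_mul_choose_eq (p - 1) k
  rw [show p - 1 + 1 = p by omega] at h
  have h := congrArg (Nat.cast : ℕ → ZMod (p ^ 2)) h
  rw [Nat.cast_mul, Nat.cast_mul, aux_pm p hp k (by omega)] at h
  have hi := aux_inv p hp (k + 1) (by omega) hk
  linear_combination (-(((k + 1 : ℕ) : ZMod (p ^ 2))⁻¹)) * h - (Nat.choose p (k + 1) : ZMod (p ^ 2)) * hi

theorem aux_alt (p : ℕ) (hp : p.Prime) (n : ℕ) (hn : 2 * n < p) :
    ∑ k ∈ Finset.range (2 * n), ((-1) ^ k * ((k + 1 : ℕ) : ZMod (p ^ 2))⁻¹)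
      = auxH p (2 * n) - auxH p n := by
  induction n with
  | zero => simp [auxH]
  | succ n ih =>
    have ih := ih (by omega)
    rw [show 2 * (n + 1) = 2 * n + 1 + 1 by ring, Finset.sum_range_succ, Finset.sum_range_succ, ih,
      auxH_succ, auxH_succ, auxH_succ p n]
    have a := aux_inv p hp (n + 1) (by omega) (by omega)
    have b := aux_inv p hp (2 * n + 1 + 1) (by omega) (by omega)
    have e : ((2 * n + 1 + 1 : ℕ) : ZMod (p ^ 2)) = 2 * ((n + 1 : ℕ) : ZMod (p ^ 2)) := by
      push_cast; ring
    have c : ((n + 1 : ℕ) : ZMod (p ^ 2))⁻¹ = 2 * ((2 * n + 1 + 1 : ℕ) : ZMod (p ^ 2))⁻¹ := by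
      generalize ((2 * n + 1 + 1 : ℕ) : ZMod (p ^ 2))⁻¹ = w at *
      rw [e] at b
      generalize ((n + 1 : ℕ) : ZMod (p ^ 2))⁻¹ = v at *
      linear_combination (-v) * b + 2 * w * a
    have s1 : (-1 : ZMod (p ^ 2)) ^ (2 * n) = 1 := by simp
    rw [pow_succ (-1 : ZMod (p ^ 2)), s1, c]
    ring

theorem aux_two (p n : ℕ) (hp : p.Prime) (hodd : Odd p) (hn : p = 2 * n + 1) :
    (2 : ZMod (p ^ 2)) ^ p = 2 - p * auxH p n := by
  have h := congrArg (Nat.cast : ℕ → ZMod (p ^ 2)) (Nat.sum_range_choose p)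
  rw [Finset.sum_range_succ, show Finset.range p = Finset.range (2 * n + 1) by rw [← hn],
    Finset.sum_range_succ'] at h
  push_cast at h
  rw [← h, Finset.sum_congr rfl (fun k hk => aux_choose1 p hp k
    (by rw [Finset.mem_range] at hk; omega)), ← Finset.mul_sum, aux_alt p hp n (by omega)]
  have w := aux_wol p hp hodd
  rw [show p - 1 = 2 * n by omega] at w
  simp only [Nat.choose_zero_right, Nat.choose_self, Nat.cast_one]
  linear_combination w

theorem choose_seven_p_halves (p : ℕ) (hp : p.Prime) (hodd : Odd p) :
    (Nat.choose ((7 * p - 1) / 2) p : ℤ) ≡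
      3 - 6 * p * fermatQuotient2 p [ZMOD (p : ℤ) ^ 2] := by
  obtain ⟨n, hn⟩ := id hodd
  have hq : (p : ℤ) * fermatQuotient2 p = 2 ^ (p - 1) - 1 := by
    unfold fermatQuotient2
    apply Int.mul_ediv_cancel'
    apply Int.ModEq.dvd
    apply Int.ModEq.symm
    apply Int.ModEq.pow_card_sub_one_eq_one hp
    rw [Int.isCoprime_iff_gcd_eq_one]
    exact Nat.coprime_two_left.mpr hodd
  have e : (3 : ℤ) - 6 * p * fermatQuotient2 p = 9 - 3 * 2 ^ p := by
    have : (2 : ℤ) ^ p = 2 ^ (p - 1) * 2 := by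
      rw [← pow_succ]; congr 1; omega
    rw [this]; linear_combination (-6) * hq
  rw [e, show (7 * p - 1) / 2 = 3 * p + n by omega]
  have : ((p : ℤ) ^ 2) = ((p ^ 2 : ℕ) : ℤ) := by push_cast; rfl
  rw [this, ← ZMod.intCast_eq_intCast_iff]
  push_cast
  rw [aux_choose3 p hp (aux_three p hp hodd) n (by omega), aux_two p n hp hodd hn]
  ring
end
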